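/- Let (V; ρ, θ, D, R_V) be a representation of a modified Rota-Baxter Lie-Yamaguti algebra (L,[-,-],{-,-,-},R). Define on the direct sum L ⊕ V the brackets [x+u, y+v]_⋉ := [x,y] + ρ(x)v - ρ(y)u, {x+u, y+v, z+w}_⋉ := {x,y,z} + D(x,y)w - θ(x,z)v + θ(y,z)u, and the linear map (R ⊕ R_V)(x+u) := Rx + R_V u, for x,y,z in L and u,v,w in V. Then (L ⊕ V, [-,-]_⋉, {-,-,-}_⋉, R ⊕ R_V) is a modified Rota-Baxter Lie-Yamaguti algebra (the semidirect product). -/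

import Mathlib

/-- A Lie-Yamaguti algebra: bilinear bracket `br`, trilinear bracket `tr`,
satisfying (LY1)-(LY6). -/
structure LieYamaguti (K : Type*) (L : Type*) [Field K] [AddCommGroup L] [Module K L] where
  br : L →ₗ[K] L →ₗ[K] L
  tr : L →ₗ[K] L →ₗ[K] L →ₗ[K] L
  ly1 : ∀ x y, br x y = - br y x
  ly2 : ∀ x y z, tr x y z = - tr y x z
  ly3 : ∀ x y z,
    br (br x y) z + br (br y z) x + br (br z x) y + tr x y z + tr y z x + tr z x y = 0
  ly4 : ∀ x y z a, tr (br x y) z a + tr (br z x) y a + tr (br y z) x a = 0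
  ly5 : ∀ a b x y, tr a b (br x y) = br (tr a b x) y + br x (tr a b y)
  ly6 : ∀ a b x y z,
    tr a b (tr x y z) = tr (tr a b x) y z + tr x (tr a b y) z + tr x y (tr a b z)

/-- A modified Rota-Baxter operator on a Lie-Yamaguti algebra. -/
def IsMRB {K L : Type*} [Field K] [AddCommGroup L] [Module K L]
    (A : LieYamaguti K L) (R : L →ₗ[K] L) : Prop :=
  (∀ x y, A.br (R x) (R y) = R (A.br (R x) y + A.br x (R y)) - A.br x y) ∧
  (∀ x y z, A.tr (R x) (R y) (R z) =
      R (A.tr x (R y) (R z) + A.tr (R x) y (R z) + A.tr (R x) (R y) z + A.tr x y z)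
      - A.tr (R x) y z - A.tr x (R y) z - A.tr x y (R z))

/-- A representation of a Lie-Yamaguti algebra on `V`, axioms (R1)-(R7). -/
structure LYRep (K L V : Type*) [Field K] [AddCommGroup L] [Module K L]
    [AddCommGroup V] [Module K V] (A : LieYamaguti K L) where
  ρ : L →ₗ[K] Module.End K V
  θ : L →ₗ[K] L →ₗ[K] Module.End K V
  D : L →ₗ[K] L →ₗ[K] Module.End K V
  r1 : ∀ x y, D x y - θ y x + θ x y + ρ (A.br x y) - ρ x * ρ y + ρ y * ρ x = 0
  r2 : ∀ x y z, D (A.br x y) z + D (A.br y z) x + D (A.br z x) y = 0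
  r3 : ∀ x y a, θ (A.br x y) a = θ x a * ρ y - θ y a * ρ x
  r4 : ∀ a b x, D a b * ρ x = ρ x * D a b + ρ (A.tr a b x)
  r5 : ∀ x a b, θ x (A.br a b) = ρ a * θ x b - ρ b * θ x a
  r6 : ∀ a b x y, D a b * θ x y = θ x y * D a b + θ (A.tr a b x) y + θ x (A.tr a b y)
  r7 : ∀ a x y z, θ a (A.tr x y z) = θ y z * θ a x - θ x z * θ a y + D x y * θ a z

/-- A representation of a modified Rota-Baxter Lie-Yamaguti algebra `(L, R)`:
a representation of the underlying Lie-Yamaguti algebra together with a linear map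
`RV` satisfying (4.1) and (4.2). -/
structure MRBRep (K L V : Type*) [Field K] [AddCommGroup L] [Module K L]
    [AddCommGroup V] [Module K V] (A : LieYamaguti K L) (R : L →ₗ[K] L)
    extends LYRep K L V A where
  RV : V →ₗ[K] V
  c41 : ∀ (x : L) (u : V), ρ (R x) (RV u) = RV (ρ (R x) u + ρ x (RV u)) - ρ x u
  c42 : ∀ (x y : L) (u : V),
    θ (R x) (R y) (RV u) =
      RV (θ (R x) (R y) u + θ (R x) y (RV u) + θ x (R y) (RV u) + θ x y u)
      - θ (R x) y u - θ x y (RV u) - θ x (R y) u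

namespace LYRep

variable {K L V : Type*} [Field K] [AddCommGroup L] [Module K L] [AddCommGroup V] [Module K V]
  {A : LieYamaguti K L} (M : LYRep K L V A)

theorem D_apply (x y : L) (w : V) :
    M.D x y w = M.θ y x w - M.θ x y w - M.ρ (A.br x y) w + M.ρ x (M.ρ y w)
      - M.ρ y (M.ρ x w) := by
  have h := LinearMap.congr_fun (M.r1 x y) w
  simp only [LinearMap.add_apply, LinearMap.sub_apply, Module.End.mul_apply,
    LinearMap.zero_apply] at h
  rw [← sub_eq_zero, ← h]
  abel

theorem D_skew (x y : L) (w : V) : M.D x y w = -M.D y x w := by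
  rw [M.D_apply x y, M.D_apply y x, A.ly1 x y, map_neg, LinearMap.neg_apply]
  abel

theorem D_cyclic (x y z : L) (w : V) :
    M.D (A.br x y) z w + M.D (A.br z x) y w + M.D (A.br y z) x w = 0 := by
  have h := LinearMap.congr_fun (M.r2 x y z) w
  simp only [LinearMap.add_apply, LinearMap.zero_apply] at h
  rw [← h]
  abel

theorem θ_br_left (x y a : L) (w : V) :
    M.θ (A.br x y) a w = M.θ x a (M.ρ y w) - M.θ y a (M.ρ x w) :=
  LinearMap.congr_fun (M.r3 x y a) w

theorem D_ρ (a b x : L) (w : V) :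
    M.D a b (M.ρ x w) = M.ρ x (M.D a b w) + M.ρ (A.tr a b x) w :=
  LinearMap.congr_fun (M.r4 a b x) w

theorem θ_br_right (x a b : L) (w : V) :
    M.θ x (A.br a b) w = M.ρ a (M.θ x b w) - M.ρ b (M.θ x a w) :=
  LinearMap.congr_fun (M.r5 x a b) w

theorem D_θ (a b x y : L) (w : V) :
    M.D a b (M.θ x y w)
      = M.θ x y (M.D a b w) + M.θ (A.tr a b x) y w + M.θ x (A.tr a b y) w :=
  LinearMap.congr_fun (M.r6 a b x y) w

theorem θ_tr (a x y z : L) (w : V) :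
    M.θ a (A.tr x y z) w
      = M.θ y z (M.θ a x w) - M.θ x z (M.θ a y w) + M.D x y (M.θ a z w) :=
  LinearMap.congr_fun (M.r7 a x y z) w

theorem D_D (a b x y : L) (w : V) :
    M.D a b (M.D x y w)
      = M.D (A.tr a b x) y w + M.D x (A.tr a b y) w + M.D x y (M.D a b w) := by
  rw [M.D_apply x y w, M.D_apply x y (M.D a b w), M.D_apply (A.tr a b x) y w,
    M.D_apply x (A.tr a b y) w]
  simp only [map_add, map_sub, M.D_ρ, M.D_θ, A.ly5, LinearMap.add_apply]
  abel

/-- The binary bracket of the semidirect product. -/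
def semidirectBr : L × V →ₗ[K] L × V →ₗ[K] L × V :=
  LinearMap.mk₂ K (fun p q => (A.br p.1 q.1, M.ρ p.1 q.2 - M.ρ q.1 p.2))
    (fun _ _ _ => by ext <;> simp; abel)
    (fun _ _ _ => by ext <;> simp [smul_sub])
    (fun _ _ _ => by ext <;> simp; abel)
    (fun _ _ _ => by ext <;> simp [smul_sub])

@[simp]
theorem semidirectBr_apply (p q : L × V) :
    M.semidirectBr p q = (A.br p.1 q.1, M.ρ p.1 q.2 - M.ρ q.1 p.2) :=
  rfl

/-- The ternary bracket of the semidirect product. -/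
def semidirectTr : L × V →ₗ[K] L × V →ₗ[K] L × V →ₗ[K] L × V :=
  LinearMap.mk₂ K
    (fun p q =>
      { toFun := fun r =>
          (A.tr p.1 q.1 r.1, M.D p.1 q.1 r.2 - M.θ p.1 r.1 q.2 + M.θ q.1 r.1 p.2)
        map_add' := fun _ _ => by ext <;> simp; abel
        map_smul' := fun _ _ => by ext <;> simp [smul_sub] })
    (fun _ _ _ => LinearMap.ext fun _ => by ext <;> simp; abel)
    (fun _ _ _ => LinearMap.ext fun _ => by ext <;> simp [smul_sub])
    (fun _ _ _ => LinearMap.ext fun _ => by ext <;> simp; abel)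
    (fun _ _ _ => LinearMap.ext fun _ => by ext <;> simp [smul_sub])

@[simp]
theorem semidirectTr_apply (p q r : L × V) :
    M.semidirectTr p q r
      = (A.tr p.1 q.1 r.1, M.D p.1 q.1 r.2 - M.θ p.1 r.1 q.2 + M.θ q.1 r.1 p.2) :=
  rfl

/-- The semidirect product Lie-Yamaguti algebra of a representation. -/
def semidirect : LieYamaguti K (L × V) where
  br := M.semidirectBr
  tr := M.semidirectTr
  ly1 p q := by
    ext
    · exact A.ly1 _ _
    · simp
  ly2 p q r := by
    ext
    · exact A.ly2 _ _ _
    · simp only [semidirectTr_apply, Prod.snd_neg, M.D_skew p.1 q.1]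
      abel
  ly3 p q r := by
    ext
    · exact A.ly3 _ _ _
    · simp only [semidirectTr_apply, semidirectBr_apply, Prod.snd_add, Prod.snd_zero,
        M.D_apply, map_sub]
      abel
  ly4 p q r s := by
    ext
    · exact A.ly4 _ _ _ _
    · simp only [semidirectTr_apply, semidirectBr_apply, Prod.snd_add, Prod.snd_zero,
        map_sub, M.θ_br_left]
      rw [← M.D_cyclic p.1 q.1 r.1 s.2]
      abel
  ly5 p q r s := by
    ext
    · exact A.ly5 _ _ _ _
    · simp only [semidirectTr_apply, semidirectBr_apply, Prod.snd_add,
        map_sub, map_add, M.θ_br_right, M.D_ρ]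
      abel
  ly6 p q r s t := by
    ext
    · exact A.ly6 _ _ _ _ _
    · simp only [semidirectTr_apply, Prod.snd_add, map_sub, map_add,
        M.θ_tr p.1 r.1 s.1 t.1, M.θ_tr q.1 r.1 s.1 t.1, M.D_θ p.1 q.1,
        M.D_D p.1 q.1 r.1 s.1 t.2]
      abel

end LYRep

namespace MRBRep

variable {K L V : Type*} [Field K] [AddCommGroup L] [Module K L] [AddCommGroup V] [Module K V]
  {A : LieYamaguti K L} {R : L →ₗ[K] L} (M : MRBRep K L V A R)

theorem ρ_ρ_RV (x y : L) (w : V) :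
    M.ρ (R x) (M.ρ (R y) (M.RV w))
      = M.RV (M.ρ x (M.ρ (R y) (M.RV w)) + M.ρ (R x) (M.ρ y (M.RV w))
          + M.ρ (R x) (M.ρ (R y) w) + M.ρ x (M.ρ y w))
        - M.ρ (R x) (M.ρ y w) - M.ρ x (M.ρ (R y) w) - M.ρ x (M.ρ y (M.RV w)) := by
  have h := M.c41 x (M.ρ (R y) w + M.ρ y (M.RV w))
  have hy : M.RV (M.ρ (R y) w + M.ρ y (M.RV w)) = M.ρ (R y) (M.RV w) + M.ρ y w := by
    rw [M.c41 y w, sub_add_cancel]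
  rw [hy] at h
  simp only [map_add] at h ⊢
  rw [eq_sub_of_add_eq h]
  abel

theorem ρ_br_RV (hR : IsMRB A R) (x y : L) (w : V) :
    M.ρ (A.br (R x) (R y)) (M.RV w)
      = M.RV (M.ρ (A.br x (R y)) (M.RV w) + M.ρ (A.br (R x) y) (M.RV w)
          + M.ρ (A.br (R x) (R y)) w + M.ρ (A.br x y) w)
        - M.ρ (A.br (R x) y) w - M.ρ (A.br x (R y)) w - M.ρ (A.br x y) (M.RV w) := by
  have h := M.c41 (A.br (R x) y + A.br x (R y)) w
  have hxy : R (A.br (R x) y + A.br x (R y)) = A.br (R x) (R y) + A.br x y := by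
    rw [hR.1 x y, sub_add_cancel]
  rw [hxy] at h
  simp only [map_add, LinearMap.add_apply] at h ⊢
  rw [eq_sub_of_add_eq h]
  abel

theorem D_RV (hR : IsMRB A R) (x y : L) (w : V) :
    M.D (R x) (R y) (M.RV w)
      = M.RV (M.D x (R y) (M.RV w) + M.D (R x) y (M.RV w) + M.D (R x) (R y) w + M.D x y w)
        - M.D (R x) y w - M.D x (R y) w - M.D x y (M.RV w) := by
  simp only [LYRep.D_apply]
  rw [M.c42 x y, M.c42 y x, M.ρ_br_RV hR, M.ρ_ρ_RV x y, M.ρ_ρ_RV y x]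
  simp only [map_add, map_sub]
  abel

theorem isMRB_semidirect (hR : IsMRB A R) :
    IsMRB M.semidirect (LinearMap.prodMap R M.RV) := by
  refine ⟨fun p q => ?_, fun p q r => ?_⟩
  · ext
    · exact hR.1 _ _
    · simp only [LYRep.semidirect, LYRep.semidirectBr_apply, LinearMap.prodMap_apply,
        Prod.snd_add, Prod.snd_sub, M.c41, map_add, map_sub]
      abel
  · ext
    · exact hR.2 _ _ _
    · simp only [LYRep.semidirect, LYRep.semidirectTr_apply, LinearMap.prodMap_apply,
        Prod.snd_add, Prod.snd_sub]
      rw [M.D_RV hR, M.c42, M.c42]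
      simp only [map_add, map_sub]
      abel

end MRBRep

/-- The semidirect product: given a representation `(V; ρ, θ, D, R_V)` of a modified
Rota-Baxter Lie-Yamaguti algebra `(L,R)`, the direct sum `L × V` carries a Lie-Yamaguti
structure with `[x+u,y+v] = [x,y] + ρ(x)v - ρ(y)u`,
`{x+u,y+v,z+w} = {x,y,z} + D(x,y)w - θ(x,z)v + θ(y,z)u`, and `R ⊕ R_V` is a modified
Rota-Baxter operator on it. -/
theorem semidirectProduct_isMRBLY (K L V : Type*) [Field K] [CharZero K]
    [AddCommGroup L] [Module K L] [AddCommGroup V] [Module K V]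
    (A : LieYamaguti K L) (R : L →ₗ[K] L) (hR : IsMRB A R)
    (rep : MRBRep K L V A R) :
    ∃ B : LieYamaguti K (L × V),
      (∀ p q : L × V, B.br p q = (A.br p.1 q.1, rep.ρ p.1 q.2 - rep.ρ q.1 p.2)) ∧
      (∀ p q r : L × V, B.tr p q r
          = (A.tr p.1 q.1 r.1,
             rep.D p.1 q.1 r.2 - rep.θ p.1 r.1 q.2 + rep.θ q.1 r.1 p.2)) ∧
      IsMRB B (LinearMap.prodMap R rep.RV) :=
  ⟨rep.semidirect, fun _ _ => rfl, fun _ _ _ => rfl, rep.isMRB_semidirect hR⟩
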